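/- arXiv:2312.12226 — 5 statements merged into one kernel-verified Lean document; each statement's English description precedes it below -/
import Mathlib

section
/- Let h be an M₀×n real matrix, δ an M₁×n real matrix, χ : n → ℝ, and ρ_A, ρ_B ∈ ℝ. Assume that δ·δᵀ + ρ_B·1, δᵀ·δ + ρ_B·1, h·hᵀ + ρ_A·1 and hᵀ·h + ρ_A·1 are all invertible. Then (δ·δᵀ + ρ_B·1)⁻¹ · δ · diag(χ) · hᵀ · (h·hᵀ + ρ_A·1)⁻¹ · h = δ · (δᵀ·δ + ρ_B·1)⁻¹ · diag(χ) · (hᵀ·h + ρ_A·1)⁻¹ · (hᵀ·h). -/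
open Matrix

theorem push_aux {m n : Type*} [Fintype m] [Fintype n] [DecidableEq m] [DecidableEq n]
    (X : Matrix m n ℝ) (Y : Matrix n m ℝ) (r : ℝ)
    (h1 : IsUnit (X * Y + r • (1 : Matrix m m ℝ)).det)
    (h2 : IsUnit (Y * X + r • (1 : Matrix n n ℝ)).det) :
    (X * Y + r • (1 : Matrix m m ℝ))⁻¹ * X = X * (Y * X + r • (1 : Matrix n n ℝ))⁻¹ := by
  have key : (X * Y + r • (1 : Matrix m m ℝ)) * X = X * (Y * X + r • (1 : Matrix n n ℝ)) := by
    simp [Matrix.add_mul, Matrix.mul_add, Matrix.mul_assoc]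
  calc _ = (X * Y + r • (1 : Matrix m m ℝ))⁻¹ * (X * (Y * X + r • (1 : Matrix n n ℝ)) *
        (Y * X + r • (1 : Matrix n n ℝ))⁻¹) := by
        rw [Matrix.mul_nonsing_inv_cancel_right _ _ h2]
    _ = _ := by
        rw [← key, Matrix.mul_assoc, Matrix.nonsing_inv_mul_cancel_left _ _ h1]

/-- K-FAC push-through identity (Eq. (10) of the paper): the one-step K-FAC update can be
rewritten so that all inverted matrices have size `n`. -/
theorem kfac_push_through {M₀ M₁ n : Type*} [Fintype M₀] [Fintype M₁] [Fintype n]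
    [DecidableEq M₀] [DecidableEq M₁] [DecidableEq n]
    (h : Matrix M₀ n ℝ) (δ : Matrix M₁ n ℝ) (χ : n → ℝ) (ρA ρB : ℝ)
    (hB : IsUnit (δ * δᵀ + ρB • (1 : Matrix M₁ M₁ ℝ)).det)
    (hB' : IsUnit (δᵀ * δ + ρB • (1 : Matrix n n ℝ)).det)
    (hA : IsUnit (h * hᵀ + ρA • (1 : Matrix M₀ M₀ ℝ)).det)
    (hA' : IsUnit (hᵀ * h + ρA • (1 : Matrix n n ℝ)).det) :
    (δ * δᵀ + ρB • (1 : Matrix M₁ M₁ ℝ))⁻¹ * δ * Matrix.diagonal χ * hᵀ *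
        (h * hᵀ + ρA • (1 : Matrix M₀ M₀ ℝ))⁻¹ * h =
      δ * (δᵀ * δ + ρB • (1 : Matrix n n ℝ))⁻¹ * Matrix.diagonal χ *
        (hᵀ * h + ρA • (1 : Matrix n n ℝ))⁻¹ * (hᵀ * h) := by
  have e1 := push_aux δ δᵀ ρB hB hB'
  have e2 := push_aux hᵀ h ρA hA' hA
  rw [e1, Matrix.mul_assoc _ hᵀ, ← e2]
  simp only [Matrix.mul_assoc]
end

section
/- Let h be an M₀×n real matrix, δ an M₁×n real matrix, D an n×n real matrix (e.g. D = diag(χ)), and ρ_L, ρ_R ∈ ℝ. Set L := δ·D·hᵀ·h·D·δᵀ and R := h·D·δᵀ·δ·D·hᵀ. Assume that L + ρ_L·1, R + ρ_R·1, D·hᵀ·h·D·δᵀ·δ + ρ_L·1 and D·δᵀ·δ·D·hᵀ·h + ρ_R·1 are all invertible. Then (L + ρ_L·1)⁻¹ · δ · D · hᵀ · (R + ρ_R·1)⁻¹ · h = δ · (D·hᵀ·h·D·δᵀ·δ + ρ_L·1)⁻¹ · D · (hᵀ·h) · (D·δᵀ·δ·D·hᵀ·h + ρ_R·1)⁻¹.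 -/
open Matrix

theorem push_aux_s8 {m n : Type*} [Fintype m] [Fintype n] [DecidableEq m] [DecidableEq n]
    (A : Matrix m m ℝ) (B : Matrix n n ℝ) (X : Matrix m n ℝ)
    (hA : IsUnit A.det) (hB : IsUnit B.det) (hX : A * X = X * B) :
    A⁻¹ * X = X * B⁻¹ := by
  calc A⁻¹ * X = A⁻¹ * (X * B) * B⁻¹ := by
        rw [← Matrix.mul_assoc, Matrix.mul_nonsing_inv_cancel_right _ _ hB]
    _ = X * B⁻¹ := by
        rw [← hX, Matrix.nonsing_inv_mul_cancel_left _ _ hA]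

/-- Shampoo push-through identity (Eqs. (S.46)–(S.52) of the paper, integer power −1):
with `L = δ·D·hᵀ·h·D·δᵀ` and `R = h·D·δᵀ·δ·D·hᵀ`, the one-step Shampoo update can be
rewritten so that all inverted matrices have size `n`. -/
theorem shampoo_push_through {M₀ M₁ n : Type*} [Fintype M₀] [Fintype M₁] [Fintype n]
    [DecidableEq M₀] [DecidableEq M₁] [DecidableEq n]
    (h : Matrix M₀ n ℝ) (δ : Matrix M₁ n ℝ) (D : Matrix n n ℝ) (ρL ρR : ℝ)
    (hL : IsUnit (δ * D * hᵀ * h * D * δᵀ + ρL • (1 : Matrix M₁ M₁ ℝ)).det)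
    (hR : IsUnit (h * D * δᵀ * δ * D * hᵀ + ρR • (1 : Matrix M₀ M₀ ℝ)).det)
    (hL' : IsUnit (D * hᵀ * h * D * δᵀ * δ + ρL • (1 : Matrix n n ℝ)).det)
    (hR' : IsUnit (D * δᵀ * δ * D * hᵀ * h + ρR • (1 : Matrix n n ℝ)).det) :
    (δ * D * hᵀ * h * D * δᵀ + ρL • (1 : Matrix M₁ M₁ ℝ))⁻¹ * δ * D * hᵀ *
        (h * D * δᵀ * δ * D * hᵀ + ρR • (1 : Matrix M₀ M₀ ℝ))⁻¹ * h =
      δ * (D * hᵀ * h * D * δᵀ * δ + ρL • (1 : Matrix n n ℝ))⁻¹ * D * (hᵀ * h) *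
        (D * δᵀ * δ * D * hᵀ * h + ρR • (1 : Matrix n n ℝ))⁻¹ := by
  have e1 := push_aux_s8 _ _ δ hL hL' (by
    simp only [Matrix.add_mul, Matrix.mul_add, Matrix.mul_assoc, Matrix.smul_mul,
      Matrix.mul_smul, Matrix.one_mul, Matrix.mul_one])
  have e2 := push_aux_s8 _ _ h hR hR' (by
    simp only [Matrix.add_mul, Matrix.mul_add, Matrix.mul_assoc, Matrix.smul_mul,
      Matrix.mul_smul, Matrix.one_mul, Matrix.mul_one])
  rw [e1, Matrix.mul_assoc _ _ h, e2]
  simp only [Matrix.mul_assoc]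
end

section
/- Let h be an M×n real matrix, y : n → ℝ, η ∈ ℝ, and ρ ∈ ℝ such that h·hᵀ + ρ·1 and hᵀ·h + ρ·1 are invertible. Define w₁ := η • ((h·hᵀ + ρ·1)⁻¹ applied to the vector h·y). Then for every v : M → ℝ, the dot product ⟨w₁, v⟩ equals η · ⟨y, ((hᵀ·h + ρ·1)⁻¹ · hᵀ) applied to v⟩. -/
open Matrix

/-- One K-FAC step from zero initialization of the last layer gives the kernel ridge
regression (NNGP) predictor: for `w₁ = η • (h·hᵀ + ρ·1)⁻¹·(h·y)` and any test feature `v`,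
`⟨w₁, v⟩ = η · ⟨y, (hᵀ·h + ρ·1)⁻¹·hᵀ·v⟩`. -/
theorem kfac_one_step_nngp {M n : Type*} [Fintype M] [Fintype n]
    [DecidableEq M] [DecidableEq n]
    (h : Matrix M n ℝ) (y : n → ℝ) (η ρ : ℝ)
    (h1 : IsUnit (h * hᵀ + ρ • (1 : Matrix M M ℝ)).det)
    (h2 : IsUnit (hᵀ * h + ρ • (1 : Matrix n n ℝ)).det) :
    ∀ v : M → ℝ,
      (η • ((h * hᵀ + ρ • (1 : Matrix M M ℝ))⁻¹.mulVec (h.mulVec y))) ⬝ᵥ v =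
        η * (y ⬝ᵥ (((hᵀ * h + ρ • (1 : Matrix n n ℝ))⁻¹ * hᵀ).mulVec v)) := by
  intro v
  have hcomm : (h * hᵀ + ρ • (1 : Matrix M M ℝ)) * h = h * (hᵀ * h + ρ • (1 : Matrix n n ℝ)) := by
    simp [Matrix.add_mul, Matrix.mul_add, Matrix.mul_assoc]
  have hBt : (hᵀ * h + ρ • (1 : Matrix n n ℝ))ᵀ = hᵀ * h + ρ • (1 : Matrix n n ℝ) := by
    simp
  generalize h * hᵀ + ρ • (1 : Matrix M M ℝ) = A at *
  generalize hᵀ * h + ρ • (1 : Matrix n n ℝ) = B at *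
  have key : A⁻¹ * h = h * B⁻¹ := by
    calc A⁻¹ * h = A⁻¹ * (h * B * B⁻¹) := by rw [Matrix.mul_nonsing_inv_cancel_right _ _ h2]
      _ = A⁻¹ * (A * (h * B⁻¹)) := by rw [← hcomm, Matrix.mul_assoc]
      _ = h * B⁻¹ := Matrix.nonsing_inv_mul_cancel_left _ _ h1
  have keyT : B⁻¹ * hᵀ = (A⁻¹ * h)ᵀ := by
    rw [key, Matrix.transpose_mul, Matrix.transpose_nonsing_inv, hBt]
  rw [keyT, Matrix.mulVec_mulVec, smul_dotProduct, smul_eq_mul, Matrix.dotProduct_mulVec,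
    Matrix.vecMul_transpose]
end

section
/- Let h be an M×n real matrix such that hᵀ·h is invertible, and y : n → ℝ. Then the map ρ ↦ ((hᵀ·h + ρ·1)⁻¹ · (hᵀ·h)) applied to the vector y tends to y as ρ → 0 along positive reals (in the topology of ℝⁿ). -/
open Matrix

/-- As the damping `ρ` vanishes along positive reals, the regularized predictions
`(hᵀ·h + ρ·1)⁻¹·(hᵀ·h)·y` tend to `y` (one K-FAC step interpolates the targets). -/
theorem kfac_damping_to_zero_interpolates {M n : Type*} [Fintype M] [Fintype n]
    [DecidableEq n]
    (h : Matrix M n ℝ) (hinv : IsUnit (hᵀ * h).det) (y : n → ℝ) :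
    Filter.Tendsto
      (fun ρ : ℝ => ((hᵀ * h + ρ • (1 : Matrix n n ℝ))⁻¹ * (hᵀ * h)).mulVec y)
      (nhdsWithin 0 (Set.Ioi 0)) (nhds y) := by
  have hc : ContinuousAt Ring.inverse (hᵀ * h).det := by
    rw [Ring.inverse_eq_inv']
    exact continuousAt_inv₀ hinv.ne_zero
  have hi := continuousAt_matrix_inv (hᵀ * h) hc
  have h1 : Filter.Tendsto (fun ρ : ℝ => hᵀ * h + ρ • (1 : Matrix n n ℝ))
      (nhds 0) (nhds (hᵀ * h)) := by
    have hcont : Continuous (fun ρ : ℝ => hᵀ * h + ρ • (1 : Matrix n n ℝ)) :=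
      continuous_const.add (continuous_id.smul continuous_const)
    simpa using hcont.tendsto 0
  have h2 := hi.tendsto.comp h1
  have hm : Continuous (fun A : Matrix n n ℝ => (A * (hᵀ * h)).mulVec y) :=
    (continuous_id.matrix_mul continuous_const).matrix_mulVec continuous_const
  have h3 := (hm.tendsto (hᵀ * h)⁻¹).comp h2
  rw [Matrix.nonsing_inv_mul _ hinv, Matrix.one_mulVec] at h3
  exact h3.mono_left nhdsWithin_le_nhds
end

section
/- Let m be a finite type, L : EuclideanSpace ℝ m → ℝ differentiable, M > 0 a real number, ω ∈ EuclideanSpace ℝ m, η′ ∈ ℝ, and (a, b, c) ∈ ℝ³. Define w₀ := M^{−b} • ω, the one-step SGD iterate w₁ := w₀ − (η′·M^{−c}) • ∇(L ∘ (M^{−a} • ·))(w₀), and the effective weights W₀ := M^{−a} • w₀ and W₁ := M^{−a} • w₁, where ∇ denotes the gradient with respect to the Euclidean inner product. Then W₁ = M^{−(a+b)} • ω − (η′·M^{−(2a+c)}) • ∇L(M^{−(a+b)} • ω). In particular, W₀ and W₁ are unchanged when (a, b, c) is replaced by (a + k, b − k, c − 2k) for any k ∈ ℝ. -/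
/-- The effective weight `W₀ = M^{-a} • w₀` before the update, where `w₀ = M^{-b} • ω`. -/
noncomputable def abcW0 {m : Type*} [Fintype m] (M : ℝ) (ω : EuclideanSpace ℝ m)
    (a b : ℝ) : EuclideanSpace ℝ m :=
  (M ^ (-a)) • ((M ^ (-b)) • ω)

/-- The effective weight `W₁ = M^{-a} • w₁` after one SGD step on the stored weight:
`w₀ = M^{-b} • ω` and `w₁ = w₀ − (η′·M^{-c}) • ∇(L ∘ (M^{-a} • ·))(w₀)`. -/
noncomputable def abcW1 {m : Type*} [Fintype m] (L : EuclideanSpace ℝ m → ℝ)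
    (M : ℝ) (ω : EuclideanSpace ℝ m) (η' a b c : ℝ) : EuclideanSpace ℝ m :=
  (M ^ (-a)) • (((M ^ (-b)) • ω) -
    (η' * M ^ (-c)) • gradient (fun w => L ((M ^ (-a)) • w)) ((M ^ (-b)) • ω))

theorem abc_W1_formula {m : Type*} [Fintype m]
    (L : EuclideanSpace ℝ m → ℝ)
    (M : ℝ) (hM : 0 < M) (ω : EuclideanSpace ℝ m) (η' a b c : ℝ) :
    abcW1 L M ω η' a b c =
      (M ^ (-(a + b))) • ω -
        (η' * M ^ (-(2 * a + c))) • gradient L ((M ^ (-(a + b))) • ω) := by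
  have hg : ∀ (s : ℝ) (x : EuclideanSpace ℝ m),
      gradient (fun w => L (s • w)) x = s • gradient L (s • x) := by
    intro s x
    unfold gradient
    rw [fderiv_comp_smul]
    simp
  have h1 : M ^ (-(a + b)) = M ^ (-a) * M ^ (-b) := by
    rw [← Real.rpow_add hM]; congr 1; ring
  have h2 : M ^ (-(2 * a + c)) = M ^ (-a) * M ^ (-a) * M ^ (-c) := by
    rw [← Real.rpow_add hM, ← Real.rpow_add hM]; congr 1; ring
  unfold abcW1
  rw [hg, h1, h2]
  simp only [smul_sub, smul_smul]
  congr 2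
  ring

/-- Scale invariance of abc-parameterizations: the effective weight after one SGD step is
`W₁ = M^{−(a+b)} • ω − (η′·M^{−(2a+c)}) • ∇L(M^{−(a+b)} • ω)`; in particular `W₀` and `W₁`
are unchanged under the shift `(a, b, c) ↦ (a + k, b − k, c − 2k)`. -/
theorem abc_shift_invariance {m : Type*} [Fintype m]
    (L : EuclideanSpace ℝ m → ℝ) (hL : Differentiable ℝ L)
    (M : ℝ) (hM : 0 < M) (ω : EuclideanSpace ℝ m) (η' a b c : ℝ) :
    abcW1 L M ω η' a b c =
      (M ^ (-(a + b))) • ω -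
        (η' * M ^ (-(2 * a + c))) • gradient L ((M ^ (-(a + b))) • ω) ∧
    ∀ k : ℝ,
      abcW0 M ω (a + k) (b - k) = abcW0 M ω a b ∧
      abcW1 L M ω η' (a + k) (b - k) (c - 2 * k) = abcW1 L M ω η' a b c := by
  refine ⟨abc_W1_formula L M hM ω η' a b c, fun k => ⟨?_, ?_⟩⟩
  · unfold abcW0
    rw [smul_smul, smul_smul, ← Real.rpow_add hM, ← Real.rpow_add hM]
    congr 2
    ring
  · rw [abc_W1_formula L M hM, abc_W1_formula L M hM]
    have e1 : a + k + (b - k) = a + b := by ring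
    have e2 : 2 * (a + k) + (c - 2 * k) = 2 * a + c := by ring
    rw [e1, e2]
end
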